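/- Let K = (k(1),...,k(n)) ∈ ℕ^n with K ≠ 0 and d^K = ∏_{i=1}^{n} d_{n,i}^{k(i)}, and let min(J) and i_(J) be as defined. Then there is a unit u ∈ F_p^× such that: if i_(J) = n, then P(min(J), i_(J))(d^K) = u · d_{n,n}^{p^{m(n)}} · d^K; and if i_(J) < n, then P(min(J), i_(J))(d^K) = u · d_{n,n}^{p^{m(n-i_(J))}} · (d^K / d_{n,n-i_(J)}^{p^{m(n-i_(J))}}), where the quotient is the monomial obtained from d^K by decreasing the exponent of d_{n,n-i_(J)} by p^{m(n-i_(J))}. -/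

import Mathlib

open MvPolynomial Matrix

/-- The algebra automorphism of `F_p[y_1,...,y_n]` induced by `g ∈ GL_n(F_p)`
(linear substitution of the variables: `y_i ↦ ∑_j g_{j i} y_j`). -/
noncomputable def glAct (p n : ℕ) (g : GL (Fin n) (ZMod p)) :
    MvPolynomial (Fin n) (ZMod p) →ₐ[ZMod p] MvPolynomial (Fin n) (ZMod p) :=
  aeval fun i => ∑ j, C ((g : Matrix (Fin n) (Fin n) (ZMod p)) j i) * X j

/-- The total Steenrod operation `P_t`, the algebra homomorphism with
`P_t(y_i) = y_i + y_i^p t`. -/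
noncomputable def Pt (p n : ℕ) :
    MvPolynomial (Fin n) (ZMod p) →ₐ[ZMod p] Polynomial (MvPolynomial (Fin n) (ZMod p)) :=
  aeval fun i => Polynomial.C (X i) + Polynomial.C (X i ^ p) * Polynomial.X

/-- The Steenrod operation `P^k`: the coefficient of `t^k` in `P_t(f)`. -/
noncomputable def steenrod (p n k : ℕ) (f : MvPolynomial (Fin n) (ZMod p)) :
    MvPolynomial (Fin n) (ZMod p) :=
  (Pt p n f).coeff k

/-- The Dickson invariant `d_{n,i}`, defined from the identity
`∏_{v ∈ F_p^n} (X + v·y) = ∑_{i=0}^n (-1)^i d_{n,i} X^{p^{n-i}}`. -/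
noncomputable def dickson (p n i : ℕ) [NeZero p] : MvPolynomial (Fin n) (ZMod p) :=
  (-1) ^ i *
    (∏ v : Fin n → ZMod p,
      (Polynomial.X + Polynomial.C (∑ j, C (v j) * X j))).coeff (p ^ (n - i))

/-- The iterated Steenrod operation `P(c,j) = P^{p^{c-j+1}} ∘ ⋯ ∘ P^{p^{c-1}} ∘ P^{p^c}`
(`P^{p^c}` applied first). -/
noncomputable def Pcj (p n c : ℕ) : ℕ → MvPolynomial (Fin n) (ZMod p) → MvPolynomial (Fin n) (ZMod p)
  | 0 => id
  | j + 1 => fun f => steenrod p n (p ^ (c + 1 - (j + 1))) (Pcj p n c j f)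

/-- Apply the composite `P^{p^{s_1}} ∘ P^{p^{s_2}} ∘ ⋯ ∘ P^{p^{s_r}}` (last entry applied first). -/
noncomputable def steenrodList (p n : ℕ) :
    List ℕ → MvPolynomial (Fin n) (ZMod p) → MvPolynomial (Fin n) (ZMod p)
  | [] => id
  | s :: rest => fun f => steenrod p n (p ^ s) (steenrodList p n rest f)

/-- The product `∏_{v ∈ F_p^n} (z + v·w)` over all `F_p`-linear combinations of `w_1, ..., w_n`. -/
noncomputable def spanProd (p : ℕ) [NeZero p] {n : ℕ} {D : Type*} [CommRing D] [Algebra (ZMod p) D]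
    (w : Fin n → D) (z : D) : D :=
  ∏ v : Fin n → ZMod p, (z + ∑ j, algebraMap (ZMod p) D (v j) * w j)

section SpanProd

variable {p : ℕ} [Fact p.Prime]

theorem prod_add_smul_of_field {L : Type*} [Field L] [Algebra (ZMod p) L] (z a : L) :
    ∏ x : ZMod p, (z + algebraMap (ZMod p) L x * a) = z ^ p - a ^ (p - 1) * z := by
  have hp : p.Prime := Fact.out
  have key : ∀ y : L, ∏ x : ZMod p, (y - algebraMap (ZMod p) L x) = y ^ p - y := by
    intro y
    have h1 : ∏ x : ZMod p, (Polynomial.X - Polynomial.C x) =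
        (Polynomial.X ^ p - Polynomial.X : Polynomial (ZMod p)) := by
      have hroots := FiniteField.roots_X_pow_card_sub_X (ZMod p)
      rw [ZMod.card] at hroots
      have hdeg := FiniteField.X_pow_card_sub_X_natDegree_eq (ZMod p) hp.one_lt
      have hmonic : (Polynomial.X ^ p - Polynomial.X : Polynomial (ZMod p)).Monic :=
        Polynomial.monic_X_pow_sub (by simpa using hp.one_lt)
      have := Polynomial.prod_multiset_X_sub_C_of_monic_of_roots_card_eq hmonic
        (by rw [hroots, hdeg]; simp [ZMod.card])
      rw [hroots] at this
      exact this
    have := congrArg (Polynomial.aeval y) h1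
    simpa [map_prod] using this
  rcases eq_or_ne a 0 with rfl | ha
  · simp [ZMod.card, zero_pow (Nat.sub_ne_zero_of_lt hp.one_lt)]
  · have h2 : ∀ x : ZMod p, z + algebraMap (ZMod p) L x * a =
        (-a) * (-(z / a) - algebraMap (ZMod p) L x) := by
      intro x; field_simp; ring
    rw [Finset.prod_congr rfl fun x _ => h2 x, Finset.prod_mul_distrib, key, Finset.prod_const,
      Finset.card_univ, ZMod.card, mul_sub, ← mul_pow]
    have h3 : -a * -(z / a) = z := by field_simp
    have h4 : (-a) ^ p = (-a) ^ (p - 1) * (-a) := by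
      rw [← pow_succ, Nat.sub_add_cancel hp.one_le]
    have h5 : (-1 : L) ^ (p - 1) = 1 := by
      have : algebraMap (ZMod p) L ((-1) ^ (p - 1)) = 1 := by
        rw [ZMod.pow_card_sub_one_eq_one (by simp), map_one]
      simpa using this
    rw [h3, h4, neg_pow a, h5]
    field_simp

theorem prod_add_smul {D : Type*} [CommRing D] [IsDomain D] [Algebra (ZMod p) D] (z a : D) :
    ∏ x : ZMod p, (z + algebraMap (ZMod p) D x * a) = z ^ p - a ^ (p - 1) * z := by
  apply IsFractionRing.injective D (FractionRing D)
  simpa [map_prod, ← IsScalarTower.algebraMap_apply] using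
    prod_add_smul_of_field (p := p) (algebraMap D (FractionRing D) z)
      (algebraMap D (FractionRing D) a)

variable {D : Type*} [CommRing D] [Algebra (ZMod p) D]

theorem map_spanProd {D' : Type*} [CommRing D'] [Algebra (ZMod p) D'] (f : D →+* D')
    {n : ℕ} (w : Fin n → D) (z : D) :
    f (spanProd p w z) = spanProd p (fun i => f (w i)) (f z) := by
  have h : ∀ x, f (algebraMap (ZMod p) D x) = algebraMap (ZMod p) D' x := fun x =>
    RingHom.congr_fun
      (RingHom.ext_zmod (f.comp (algebraMap (ZMod p) D)) (algebraMap (ZMod p) D')) x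
  simp [spanProd, map_prod, h]

theorem spanProd_zero (w : Fin 0 → D) (z : D) : spanProd p w z = z := by
  simp [spanProd]

theorem spanProd_succ_eq_prod {n : ℕ} (w : Fin (n + 1) → D) (z : D) :
    spanProd p w z = ∏ x : ZMod p,
      spanProd p (Fin.tail w) (z + algebraMap (ZMod p) D x * w 0) := by
  unfold spanProd
  rw [← (Fin.consEquiv fun _ => ZMod p).prod_comp, Fintype.prod_prod_type]
  simp [Fin.consEquiv, Fin.sum_univ_succ, Fin.tail, add_assoc]

variable [IsDomain D] [CharP D p]

theorem spanProd_add_smul {n : ℕ} (w : Fin n → D) :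
    ∀ (z y : D) (x : ZMod p), spanProd p w (z + algebraMap (ZMod p) D x * y) =
      spanProd p w z + algebraMap (ZMod p) D x * spanProd p w y := by
  induction n with
  | zero => simp [spanProd_zero]
  | succ n ih =>
    intro z y x
    have hs : ∀ z, spanProd p w z = spanProd p (Fin.tail w) z ^ p -
        spanProd p (Fin.tail w) (w 0) ^ (p - 1) * spanProd p (Fin.tail w) z := fun z => by
      rw [spanProd_succ_eq_prod, ← prod_add_smul]
      exact Finset.prod_congr rfl fun x _ => ih _ _ _ _
    rw [hs, hs, hs, ih, add_pow_char, mul_pow, ← map_pow, ZMod.pow_card]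
    ring

theorem spanProd_succ {n : ℕ} (w : Fin (n + 1) → D) (z : D) :
    spanProd p w z = spanProd p (Fin.tail w) z ^ p -
      spanProd p (Fin.tail w) (w 0) ^ (p - 1) * spanProd p (Fin.tail w) z := by
  rw [spanProd_succ_eq_prod, ← prod_add_smul]
  exact Finset.prod_congr rfl fun x _ => spanProd_add_smul _ _ _ _

end SpanProd

section SpanPoly

variable {p : ℕ} [Fact p.Prime] {B : Type*} [CommRing B]

theorem coeff_sum_pow_pow (q : ℕ → B) {n k : ℕ} (hk : k ≤ n) :
    (∑ j ∈ Finset.range (n + 1), Polynomial.C (q j) * Polynomial.X ^ p ^ j).coeff (p ^ k) =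
      q k := by
  have hp : 1 < p := (Fact.out : p.Prime).one_lt
  simp [Polynomial.finsetSum_coeff, Polynomial.coeff_X_pow, Nat.pow_right_inj hp]
  omega

variable [Algebra (ZMod p) B]

theorem spanProd_comp {n : ℕ} (w : Fin n → B) (z : Polynomial B) :
    (spanProd p (fun i => Polynomial.C (w i)) Polynomial.X).comp z =
      spanProd p (fun i => Polynomial.C (w i)) z := by
  have := map_spanProd (p := p) (Polynomial.compRingHom z) (fun i => Polynomial.C (w i))
    Polynomial.X
  simpa using this

variable [IsDomain B] [CharP B p]

/-- The span polynomial is a `p`-polynomial, monic of degree `p ^ n`. -/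
theorem exists_spanProd_eq_sum {n : ℕ} (w : Fin n → B) :
    ∃ q : ℕ → B, q n = 1 ∧ (∀ j, n < j → q j = 0) ∧
      spanProd p (fun i => Polynomial.C (w i)) Polynomial.X =
        ∑ j ∈ Finset.range (n + 1), Polynomial.C (q j) * Polynomial.X ^ p ^ j := by
  induction n with
  | zero =>
    refine ⟨fun j => if j = 0 then 1 else 0, by simp, fun j hj => by simp; omega, ?_⟩
    simp [spanProd_zero]
  | succ n ih =>
    obtain ⟨q, hqn, hq0, hq⟩ := ih (Fin.tail w)
    set a := spanProd p (Fin.tail w) (w 0) with ha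
    refine ⟨fun j => (if j = 0 then 0 else q (j - 1) ^ p) - a ^ (p - 1) * q j, ?_, ?_, ?_⟩
    · simp [hqn, hq0]
    · intro j hj
      have hp : p ≠ 0 := (Fact.out : p.Prime).ne_zero
      simp [hq0 j (by omega), hq0 (j - 1) (by omega), hp]
    · have h1 : spanProd p (Fin.tail fun i => Polynomial.C (w i)) (Polynomial.C (w 0)) =
          Polynomial.C a := (map_spanProd Polynomial.C _ _).symm
      have h2 : Fin.tail (fun i => Polynomial.C (w i)) =
        fun i => Polynomial.C (Fin.tail w i) := rfl
      rw [spanProd_succ, h1, h2, hq, sum_pow_char]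
      simp only [map_sub, sub_mul, Finset.sum_sub_distrib]
      congr 1
      · rw [Finset.sum_range_succ' _ (n + 1)]
        simp [mul_pow, ← pow_mul, pow_succ]
      · rw [Finset.sum_range_succ _ (n + 1), hq0 (n + 1) (by omega), Finset.mul_sum]
        simp [mul_assoc]

/-- Evaluating the span polynomial of the twisted family `w_i + t w_i^p` at `z + t z^p`. -/
theorem exists_spanProd_twist {n : ℕ} (w : Fin n → B) (t : B) :
    ∃ E : B, ∀ z : Polynomial B,
      spanProd p (fun i => Polynomial.C (w i + t * w i ^ p)) (z + Polynomial.C t * z ^ p) =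
        Polynomial.C E * spanProd p (fun i => Polynomial.C (w i)) z +
          Polynomial.C t ^ p ^ n * spanProd p (fun i => Polynomial.C (w i)) z ^ p := by
  induction n with
  | zero => exact ⟨1, fun z => by simp [spanProd_zero]⟩
  | succ n ih =>
    obtain ⟨E, hE⟩ := ih (Fin.tail w)
    set a := spanProd p (Fin.tail w) (w 0) with ha
    refine ⟨E * (E + t ^ p ^ n * a ^ (p - 1)) ^ (p - 1), fun z => ?_⟩
    have h1 : spanProd p (fun i => Polynomial.C (Fin.tail w i)) (Polynomial.C (w 0)) =
        Polynomial.C a := (map_spanProd Polynomial.C _ _).symm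
    have h2 := hE (Polynomial.C (w 0))
    rw [h1] at h2
    have t1 : Fin.tail (fun i => Polynomial.C (w i)) =
      fun i => Polynomial.C (Fin.tail w i) := rfl
    have t2 : Fin.tail (fun i => Polynomial.C (w i + t * w i ^ p)) =
      fun i => Polynomial.C (Fin.tail w i + t * Fin.tail w i ^ p) := rfl
    have h3 : Polynomial.C (w 0 + t * w 0 ^ p) =
      Polynomial.C (w 0) + Polynomial.C t * Polynomial.C (w 0) ^ p := by simp
    rw [spanProd_succ, spanProd_succ, t1, t2, h1, h3, h2, hE]
    generalize spanProd p (fun i => Polynomial.C (Fin.tail w i)) z = A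
    simp only [map_mul, map_pow, map_add]
    generalize Polynomial.C E = E
    rw [pow_succ p n, pow_mul]
    generalize Polynomial.C t ^ p ^ n = T
    generalize Polynomial.C a = a
    have hp : p - 1 + 1 = p := Nat.sub_add_cancel (Fact.out : p.Prime).one_le
    have k1 : (E * a + T * a ^ p) ^ (p - 1) =
        a ^ (p - 1) * (E + T * a ^ (p - 1)) ^ (p - 1) := by
      rw [← mul_pow]
      congr 1
      rw [mul_add, mul_left_comm a T, ← pow_succ', hp, mul_comm a]
    have k2 : (E + T * a ^ (p - 1)) ^ (p - 1) * (E + T * a ^ (p - 1)) =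
        E ^ p + T ^ p * (a ^ (p - 1)) ^ p := by
      rw [← pow_succ, hp, add_pow_char, mul_pow]
    rw [k1, add_pow_char, sub_pow_char, mul_pow, mul_pow, mul_pow]
    linear_combination -A ^ p * k2

theorem exists_coeff_spanProd_twist {n : ℕ} (w : Fin n → B) (t : B) (a b : ℕ → B)
    (ha : ∀ j, a j = (spanProd p (fun i => Polynomial.C (w i + t * w i ^ p))
      Polynomial.X).coeff (p ^ j))
    (hb : ∀ j, b j = (spanProd p (fun i => Polynomial.C (w i)) Polynomial.X).coeff (p ^ j)) :
    ∃ E : B, t ^ p ^ n ∣ a 0 - E * b 0 ∧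
      ∀ j < n, t ^ p ^ n ∣ a (j + 1) + t ^ p ^ j * a j - E * b (j + 1) := by
  have hp : 1 < p := (Fact.out : p.Prime).one_lt
  obtain ⟨E, hE⟩ := exists_spanProd_twist (p := p) w t
  obtain ⟨q, -, -, hq⟩ := exists_spanProd_eq_sum (p := p) fun i => w i + t * w i ^ p
  specialize hE Polynomial.X
  have hqa : ∀ j ≤ n, q j = a j := fun j hj => by rw [ha, hq, coeff_sum_pow_pow q hj]
  rw [← spanProd_comp, hq] at hE
  generalize hG : spanProd p (fun i => Polynomial.C (w i)) Polynomial.X ^ p = G at hE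
  have hL : (∑ j ∈ Finset.range (n + 1), Polynomial.C (q j) * Polynomial.X ^ p ^ j).comp
      (Polynomial.X + Polynomial.C t * Polynomial.X ^ p) =
      (∑ j ∈ Finset.range (n + 1), Polynomial.C (q j) * Polynomial.X ^ p ^ j) +
      ∑ j ∈ Finset.range (n + 1),
        Polynomial.C (t ^ p ^ j * q j) * Polynomial.X ^ p ^ (j + 1) := by
    rw [← Finset.sum_add_distrib, Polynomial.sum_comp]
    refine Finset.sum_congr rfl fun j _ => ?_
    simp only [Polynomial.mul_comp, Polynomial.C_comp, Polynomial.pow_comp, Polynomial.X_comp]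
    rw [add_pow_char_pow, mul_pow, ← pow_mul, ← pow_succ']
    simp only [map_mul, map_pow]
    ring
  rw [hL] at hE
  have key : ∀ k ≤ n, a k + ((∑ j ∈ Finset.range (n + 1),
        Polynomial.C (t ^ p ^ j * q j) * Polynomial.X ^ p ^ (j + 1)).coeff (p ^ k)) =
      E * b k + t ^ p ^ n * G.coeff (p ^ k) := by
    intro k hk
    have := congrArg (fun f => Polynomial.coeff f (p ^ k)) hE
    simp only [Polynomial.coeff_add, Polynomial.coeff_C_mul, ← Polynomial.C_pow,
      coeff_sum_pow_pow q hk, hqa k hk, ← hb] at this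
    exact this
  refine ⟨E, ⟨G.coeff (p ^ 0), ?_⟩, fun j hj => ⟨G.coeff (p ^ (j + 1)), ?_⟩⟩
  · have := key 0 (Nat.zero_le _)
    rw [Polynomial.finsetSum_coeff, Finset.sum_eq_zero, add_zero] at this
    · rw [this]; ring
    · intro j _
      rw [Polynomial.coeff_C_mul, Polynomial.coeff_X_pow, if_neg, mul_zero]
      rw [Nat.pow_right_inj hp]
      omega
  · have := key (j + 1) hj
    rw [Polynomial.finsetSum_coeff, Finset.sum_eq_single j] at this
    · rw [Polynomial.coeff_C_mul, Polynomial.coeff_X_pow, if_pos rfl, mul_one,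
        hqa j hj.le] at this
      rw [this]; ring
    · intro i _ hi
      rw [Polynomial.coeff_C_mul, Polynomial.coeff_X_pow, if_neg, mul_zero]
      rw [Nat.pow_right_inj hp]
      omega
    · intro h
      simp at h
      omega

end SpanPoly

section Steenrod

variable {p n : ℕ}

/-- `P_t f ≡ f` modulo `t ^ l`. -/
def PtStable (p n : ℕ) (f : MvPolynomial (Fin n) (ZMod p)) (l : ℕ) : Prop :=
  Polynomial.X ^ l ∣ Pt p n f - Polynomial.C f

/-- `P_t f ≡ f + g t ^ l` modulo `t ^ (l + 1)`. -/
def PtLead (p n : ℕ) (f : MvPolynomial (Fin n) (ZMod p)) (l : ℕ)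
    (g : MvPolynomial (Fin n) (ZMod p)) : Prop :=
  Polynomial.X ^ (l + 1) ∣ Pt p n f - Polynomial.C f - Polynomial.X ^ l * Polynomial.C g

variable {f f' g g' : MvPolynomial (Fin n) (ZMod p)} {l l' : ℕ}

theorem ptStable_one (f : MvPolynomial (Fin n) (ZMod p)) : PtStable p n f 1 := by
  have h : ((Polynomial.aeval (0 : MvPolynomial (Fin n) (ZMod p))).restrictScalars (ZMod p)).comp
      (Pt p n) = AlgHom.id _ _ := by
    ext i
    simp [Pt]
  have h' := DFunLike.congr_fun h f
  rw [PtStable, pow_one, Polynomial.X_dvd_iff, Polynomial.coeff_sub, Polynomial.coeff_C_zero,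
    Polynomial.coeff_zero_eq_aeval_zero, sub_eq_zero]
  simpa using h'

theorem PtStable.mono (h : PtStable p n f l) (hl : l' ≤ l) : PtStable p n f l' :=
  (pow_dvd_pow _ hl).trans h

theorem PtStable.lead (h : PtStable p n f l) (hl : l' < l) : PtLead p n f l' 0 := by
  simpa [PtLead, PtStable] using h.mono (Nat.succ_le_of_lt hl)

theorem PtStable.one_left (l : ℕ) : PtStable p n 1 l := by
  simp [PtStable]

theorem PtStable.mul (h : PtStable p n f l) (h' : PtStable p n f' l) :
    PtStable p n (f * f') l := by
  have : Pt p n (f * f') - Polynomial.C (f * f') =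
      (Pt p n f - Polynomial.C f) * Pt p n f' +
        Polynomial.C f * (Pt p n f' - Polynomial.C f') := by
    simp only [map_mul]; ring
  rw [PtStable, this]
  exact dvd_add (h.mul_right _) (h'.mul_left _)

theorem PtStable.pow (h : PtStable p n f l) (a : ℕ) : PtStable p n (f ^ a) l := by
  induction a with
  | zero => simpa using PtStable.one_left l
  | succ a ih => rw [pow_succ]; exact ih.mul h

theorem PtStable.prod {ι : Type*} {s : Finset ι} {F : ι → MvPolynomial (Fin n) (ZMod p)}
    (h : ∀ i ∈ s, PtStable p n (F i) l) : PtStable p n (∏ i ∈ s, F i) l :=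
  Finset.prod_induction _ (fun f => PtStable p n f l) (fun _ _ => PtStable.mul)
    (PtStable.one_left l) h

theorem PtLead.stable (h : PtLead p n f l g) : PtStable p n f l := by
  have := dvd_add ((pow_dvd_pow _ (Nat.le_succ l)).trans h)
    (Dvd.intro (Polynomial.C g) rfl : Polynomial.X ^ l ∣ Polynomial.X ^ l * Polynomial.C g)
  rwa [sub_add_cancel] at this

theorem PtLead.mul (hl : 0 < l) (h : PtLead p n f l g) (h' : PtLead p n f' l g') :
    PtLead p n (f * f') l (f * g' + f' * g) := by
  have : Pt p n (f * f') - Polynomial.C (f * f') -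
      Polynomial.X ^ l * Polynomial.C (f * g' + f' * g) =
      (Pt p n f - Polynomial.C f - Polynomial.X ^ l * Polynomial.C g) * Pt p n f' +
        (Polynomial.C f + Polynomial.X ^ l * Polynomial.C g) *
          (Pt p n f' - Polynomial.C f' - Polynomial.X ^ l * Polynomial.C g') +
        Polynomial.X ^ (l + l) * (Polynomial.C g * Polynomial.C g') := by
    simp only [map_mul, map_add]; ring
  rw [PtLead, this]
  exact dvd_add (dvd_add (h.mul_right _) (h'.mul_left _))
    ((pow_dvd_pow _ (by omega)).mul_right _)

theorem PtLead.pow_succ (hl : 0 < l) (h : PtLead p n f l g) (a : ℕ) :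
    PtLead p n (f ^ (a + 1)) l (C ((a + 1 : ℕ) : ZMod p) * (f ^ a * g)) := by
  induction a with
  | zero => simpa using h
  | succ a ih =>
    rw [_root_.pow_succ f (a + 1)]
    convert ih.mul hl h using 1
    push_cast [map_add, map_natCast, map_one]
    ring

theorem PtLead.prod (hl : 0 < l) {ι : Type*} [DecidableEq ι] {s : Finset ι}
    {F G : ι → MvPolynomial (Fin n) (ZMod p)} (h : ∀ i ∈ s, PtLead p n (F i) l (G i)) :
    PtLead p n (∏ i ∈ s, F i) l (∑ i ∈ s, G i * ∏ j ∈ s.erase i, F j) := by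
  induction s using Finset.induction_on with
  | empty => simpa using (PtStable.one_left (l + 1)).lead (Nat.lt_succ_self l)
  | insert a s ha ih =>
    rw [Finset.prod_insert ha]
    convert (h a (Finset.mem_insert_self a s)).mul hl
      (ih fun i hi => h i (Finset.mem_insert_of_mem hi)) using 1
    rw [Finset.sum_insert ha, Finset.erase_insert ha, add_comm, Finset.mul_sum, mul_comm (G a)]
    congr 1
    refine Finset.sum_congr rfl fun i hi => ?_
    have hia : a ≠ i := fun e => ha (e ▸ hi)
    rw [Finset.erase_insert_of_ne hia, Finset.prod_insert fun h => ha (Finset.mem_of_mem_erase h)]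
    ring

theorem PtLead.steenrod_eq (h : PtLead p n f l g) (hl : 0 < l) : steenrod p n l f = g := by
  have := Polynomial.X_pow_dvd_iff.1 h l (Nat.lt_succ_self l)
  simpa [steenrod, Polynomial.coeff_C, hl.ne', Polynomial.coeff_X_pow_mul', sub_eq_zero] using this

theorem steenrod_sum {ι : Type*} (k : ℕ) (s : Finset ι)
    (F : ι → MvPolynomial (Fin n) (ZMod p)) :
    steenrod p n k (∑ i ∈ s, F i) = ∑ i ∈ s, steenrod p n k (F i) := by
  simp [steenrod, Polynomial.finsetSum_coeff]

theorem steenrod_C_mul (k : ℕ) (a : ZMod p) (f : MvPolynomial (Fin n) (ZMod p)) :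
    steenrod p n k (C a * f) = C a * steenrod p n k f := by
  simp only [steenrod, ← smul_eq_C_mul, map_smul, Polynomial.coeff_smul]

theorem PtLead.C_mul (a : ZMod p) (h : PtLead p n f l g) : PtLead p n (C a * f) l (C a * g) := by
  have ha : Pt p n (C a) = Polynomial.C (C a) := (Pt p n).commutes a
  have : Pt p n (C a * f) - Polynomial.C (C a * f) - Polynomial.X ^ l * Polynomial.C (C a * g) =
      Polynomial.C (C a) *
        (Pt p n f - Polynomial.C f - Polynomial.X ^ l * Polynomial.C g) := by
    simp only [map_mul, ha]; ring
  rw [PtLead, this]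
  exact h.mul_left _

variable [Fact p.Prime]

instance charP_mvPolynomial_zmod (σ : Type*) : CharP (MvPolynomial σ (ZMod p)) p :=
  charP_of_injective_ringHom (C_injective σ (ZMod p)) p

theorem PtLead.pow_char_pow (h : PtLead p n f l g) (m : ℕ) :
    PtLead p n (f ^ p ^ m) (l * p ^ m) (g ^ p ^ m) := by
  have hp : 0 < p ^ m := pow_pos (Fact.out : p.Prime).pos m
  have : Pt p n (f ^ p ^ m) - Polynomial.C (f ^ p ^ m) -
      Polynomial.X ^ (l * p ^ m) * Polynomial.C (g ^ p ^ m) =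
      (Pt p n f - Polynomial.C f - Polynomial.X ^ l * Polynomial.C g) ^ p ^ m := by
    rw [sub_pow_char_pow, sub_pow_char_pow, mul_pow, pow_mul]
    simp only [map_pow]
  rw [PtLead, this]
  refine Dvd.dvd.trans ?_ (pow_dvd_pow_of_dvd h (p ^ m))
  rw [← pow_mul]
  exact pow_dvd_pow _ (by rw [add_mul]; omega)

theorem dickson_eq (i : ℕ) : dickson p n i = (-1) ^ i *
    (spanProd p (fun j : Fin n => Polynomial.C (X j : MvPolynomial (Fin n) (ZMod p)))
      Polynomial.X).coeff (p ^ (n - i)) := by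
  have h : ∀ x : ZMod p, algebraMap (ZMod p) (Polynomial (MvPolynomial (Fin n) (ZMod p))) x =
    Polynomial.C (C x) := fun _ => rfl
  simp [dickson, spanProd, h, map_sum]

theorem exists_Pt_coeff_spanProd (q : ℕ → MvPolynomial (Fin n) (ZMod p))
    (hq : ∀ j, q j = (spanProd p (fun i : Fin n =>
      Polynomial.C (X i : MvPolynomial (Fin n) (ZMod p))) Polynomial.X).coeff (p ^ j)) :
    ∃ E, Polynomial.X ^ p ^ n ∣ Pt p n (q 0) - E * Polynomial.C (q 0) ∧
      ∀ j < n, Polynomial.X ^ p ^ n ∣ Pt p n (q (j + 1)) +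
        Polynomial.X ^ p ^ j * Pt p n (q j) - E * Polynomial.C (q (j + 1)) := by
  refine exists_coeff_spanProd_twist (p := p)
    (fun i : Fin n => Polynomial.C (X i : MvPolynomial (Fin n) (ZMod p))) Polynomial.X
    (fun j => Pt p n (q j)) (fun j => Polynomial.C (q j)) (fun j => ?_) fun j => ?_
  · have h := map_spanProd (p := p)
      (D' := Polynomial (Polynomial (MvPolynomial (Fin n) (ZMod p))))
      (Polynomial.mapRingHom (Pt p n).toRingHom)
      (fun i : Fin n => Polynomial.C (X i : MvPolynomial (Fin n) (ZMod p))) Polynomial.X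
    have h' := congrArg (fun f => Polynomial.coeff f (p ^ j)) h
    simp only [Polynomial.coe_mapRingHom, Polynomial.coeff_map, ← hq, Polynomial.map_C,
      Polynomial.map_X] at h'
    refine h'.trans ?_
    congr 3
    funext i
    congr 1
    simp [Pt, mul_comm]
  · have h := map_spanProd (p := p)
      (D' := Polynomial (Polynomial (MvPolynomial (Fin n) (ZMod p)))) (Polynomial.mapRingHom
        (Polynomial.C : MvPolynomial (Fin n) (ZMod p) →+* _))
      (fun i : Fin n => Polynomial.C (X i : MvPolynomial (Fin n) (ZMod p))) Polynomial.X
    have h' := congrArg (fun f => Polynomial.coeff f (p ^ j)) h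
    simpa only [Polynomial.coe_mapRingHom, Polynomial.coeff_map, ← hq, Polynomial.map_C,
      Polynomial.map_X] using h'

theorem ptLead_coeff_spanProd (hn : 0 < n) (q : ℕ → MvPolynomial (Fin n) (ZMod p))
    (hq : ∀ j, q j = (spanProd p (fun i : Fin n =>
      Polynomial.C (X i : MvPolynomial (Fin n) (ZMod p))) Polynomial.X).coeff (p ^ j)) :
    PtLead p n (q 0) (p ^ (n - 1)) (q (n - 1) * q 0) ∧
      ∀ j, j + 1 < n → PtLead p n (q (j + 1)) (p ^ j) (-q j) := by
  have hp : 1 < p := (Fact.out : p.Prime).one_lt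
  obtain ⟨E, h0, hE⟩ := exists_Pt_coeff_spanProd q hq
  have hqn : q n = 1 := by
    obtain ⟨r, hrn, -, hr⟩ := exists_spanProd_eq_sum (p := p)
      fun i : Fin n => (X i : MvPolynomial (Fin n) (ZMod p))
    rw [hq, hr, coeff_sum_pow_pow r le_rfl, hrn]
  have hle : p ^ (n - 1) + 1 ≤ p ^ n := Nat.pow_lt_pow_right hp (by omega)
  have htop := hE (n - 1) (by omega)
  rw [Nat.sub_add_cancel hn, hqn, map_one, map_one, mul_one] at htop
  have hst : ∀ j, Polynomial.X ∣ Pt p n (q j) - Polynomial.C (q j) := fun j => by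
    simpa [PtStable] using ptStable_one (q j)
  have hsh : ∀ l j, Polynomial.X ^ (l + 1) ∣
      Polynomial.X ^ l * (Pt p n (q j) - Polynomial.C (q j)) := fun l j => by
    rw [pow_succ]; exact mul_dvd_mul_left _ (hst j)
  constructor
  · have : Pt p n (q 0) - Polynomial.C (q 0) -
        Polynomial.X ^ p ^ (n - 1) * Polynomial.C (q (n - 1) * q 0) =
        (Pt p n (q 0) - E * Polynomial.C (q 0)) -
          (1 + Polynomial.X ^ p ^ (n - 1) * Pt p n (q (n - 1)) - E) * Polynomial.C (q 0) +
          Polynomial.X ^ p ^ (n - 1) * (Pt p n (q (n - 1)) - Polynomial.C (q (n - 1))) *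
            Polynomial.C (q 0) := by
      rw [map_mul]; ring
    rw [PtLead, this]
    exact dvd_add (dvd_sub ((pow_dvd_pow _ hle).trans h0)
      (((pow_dvd_pow _ hle).trans htop).mul_right _)) ((hsh _ _).mul_right _)
  · intro j hj
    have hle' : p ^ j + 1 ≤ p ^ (n - 1) := Nat.pow_lt_pow_right hp (by omega)
    have : Pt p n (q (j + 1)) - Polynomial.C (q (j + 1)) -
        Polynomial.X ^ p ^ j * Polynomial.C (-q j) =
        (Pt p n (q (j + 1)) + Polynomial.X ^ p ^ j * Pt p n (q j) -
          E * Polynomial.C (q (j + 1))) -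
        (1 + Polynomial.X ^ p ^ (n - 1) * Pt p n (q (n - 1)) - E) * Polynomial.C (q (j + 1)) +
        Polynomial.X ^ p ^ (n - 1) * (Pt p n (q (n - 1)) * Polynomial.C (q (j + 1))) -
        Polynomial.X ^ p ^ j * (Pt p n (q j) - Polynomial.C (q j)) := by
      rw [map_neg]; ring
    rw [PtLead, this]
    have hle2 := hle'.trans (Nat.le_of_succ_le hle)
    exact dvd_sub (dvd_add (dvd_sub ((pow_dvd_pow _ hle2).trans (hE j (by omega)))
      (((pow_dvd_pow _ hle2).trans htop).mul_right _))
      ((pow_dvd_pow _ hle').mul_right _)) (hsh _ _)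

theorem ptLead_dickson {i : ℕ} (hi1 : 1 ≤ i) (hin : i < n) :
    PtLead p n (dickson p n i) (p ^ (n - i - 1)) (dickson p n (i + 1)) := by
  have h := (ptLead_coeff_spanProd (p := p) (n := n) (by omega) _ fun _ => rfl).2
    (n - i - 1) (by omega)
  have h' := h.C_mul ((-1) ^ i)
  rw [dickson_eq, dickson_eq]
  convert h' using 1
  · simp [show n - i - 1 + 1 = n - i by omega]
  · simp [pow_succ, Nat.sub_sub]

theorem ptLead_dickson_top (hn : 0 < n) :
    PtLead p n (dickson p n n) (p ^ (n - 1)) (-(dickson p n 1 * dickson p n n)) := by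
  have h := (ptLead_coeff_spanProd (p := p) (n := n) hn _ fun _ => rfl).1
  have h' := h.C_mul ((-1) ^ n)
  rw [dickson_eq, dickson_eq]
  convert h' using 1
  · simp
  · simp; ring

theorem ptLead_dickson_pow {i k μ : ℕ} (hi1 : 1 ≤ i) (hin : i ≤ n) (hk : p ^ μ ∣ k)
    (hk' : ¬ p ^ (μ + 1) ∣ k) :
    ∃ β : ZMod p, β ≠ 0 ∧
      PtLead p n (dickson p n i ^ k) (p ^ ((if i = n then n else n - i) - 1 + μ))
        (C β * (dickson p n (n - (if i = n then n else n - i) + 1) ^ p ^ μ *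
          dickson p n i ^ (if i = n then k else k - p ^ μ))) := by
  have hp : p.Prime := Fact.out
  obtain ⟨b, rfl⟩ := hk
  have hb : ¬ p ∣ b := fun h => hk' (by rw [pow_succ]; exact mul_dvd_mul_left _ h)
  have hb0 : (b : ZMod p) ≠ 0 := by rwa [Ne, CharP.cast_eq_zero_iff (ZMod p) p]
  obtain ⟨a, rfl⟩ : ∃ a, b = a + 1 :=
    Nat.exists_eq_succ_of_ne_zero (by rintro rfl; exact hb (dvd_zero p))
  rw [pow_mul]
  have hpos : ∀ e, 0 < p ^ e * p ^ μ := fun e => mul_pos (pow_pos hp.pos _) (pow_pos hp.pos _)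
  rcases hin.eq_or_lt with rfl | hlt
  · refine ⟨((a + 1 : ℕ) : ZMod p) * (-1) ^ p ^ μ, mul_ne_zero hb0 (by simp), ?_⟩
    have h := (((ptLead_dickson_top (p := p) hi1).pow_char_pow μ).pow_succ (hpos _) a)
    rw [← pow_add] at h
    convert h using 1
    · simp
    · have hpow : dickson p i i ^ (p ^ μ * (a + 1)) =
          (dickson p i i ^ p ^ μ) ^ a * dickson p i i ^ p ^ μ := by
        rw [pow_mul, pow_succ]
      have hneg : (-(dickson p i 1 * dickson p i i)) ^ p ^ μ =
          (-1) ^ p ^ μ * (dickson p i 1 ^ p ^ μ * dickson p i i ^ p ^ μ) := by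
        rw [neg_pow, mul_pow]
      simp only [if_true, Nat.sub_self, zero_add, hpow, hneg, map_mul, map_pow, map_neg, map_one]
      ring
  · refine ⟨((a + 1 : ℕ) : ZMod p), hb0, ?_⟩
    have h := (((ptLead_dickson (p := p) hi1 hlt).pow_char_pow μ).pow_succ (hpos _) a)
    rw [← pow_add] at h
    convert h using 1
    · simp [hlt.ne]
    · have hpow : dickson p n i ^ (p ^ μ * (a + 1) - p ^ μ) = (dickson p n i ^ p ^ μ) ^ a := by
        rw [← pow_mul, mul_add, mul_one, Nat.add_sub_cancel]
      rw [if_neg hlt.ne, if_neg hlt.ne, hpow, show n - (n - i) + 1 = i + 1 by omega]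
      ring

theorem ptStable_dickson_pow {i k μ : ℕ} (hi1 : 1 ≤ i) (hin : i ≤ n) (hk : p ^ μ ∣ k) :
    PtStable p n (dickson p n i ^ k) (p ^ ((if i = n then n else n - i) - 1 + μ)) := by
  obtain ⟨b, rfl⟩ := hk
  rw [pow_mul, pow_add]
  refine PtStable.pow ?_ b
  rcases hin.eq_or_lt with rfl | hlt
  · simpa using ((ptLead_dickson_top (p := p) hi1).pow_char_pow μ).stable
  · simpa [hlt.ne] using ((ptLead_dickson (p := p) hi1 hlt).pow_char_pow μ).stable

/-- Iterated Steenrod operations on a sum of terms whose leading Dickson factors are moved one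
step along the chain `d_1 ↦ d_2 ↦ ⋯ ↦ d_n` by each operation. -/
theorem Pcj_eq_sum_of_steenrod_eq {c : ℕ} {S : Finset ℕ} {s μ : ℕ → ℕ} {β : ℕ → ZMod p}
    {M : ℕ → MvPolynomial (Fin n) (ZMod p)} {f : MvPolynomial (Fin n) (ZMod p)}
    (hs : ∀ i ∈ S, 1 ≤ s i ∧ s i ≤ n ∧ μ i + s i = c + 1)
    (hM : ∀ i ∈ S, PtStable p n (M i) (p ^ c))
    (hf : steenrod p n (p ^ c) f =
      ∑ i ∈ S, C (β i) * (dickson p n (n - s i + 1) ^ p ^ μ i * M i))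
    {j : ℕ} (hj1 : 1 ≤ j) (hjc : j ≤ c + 1) :
    Pcj p n c j f =
      ∑ i ∈ S with j ≤ s i, C (β i) * (dickson p n (n - s i + j) ^ p ^ μ i * M i) := by
  have hp : p.Prime := Fact.out
  induction j, hj1 using Nat.le_induction with
  | base =>
    rw [Finset.filter_true_of_mem fun i hi => (hs i hi).1, ← hf]
    simp [Pcj]
  | succ j hj ih =>
    change steenrod p n (p ^ (c + 1 - (j + 1))) (Pcj p n c j f) = _
    rw [ih (by omega), steenrod_sum, Nat.add_sub_add_right]
    have hpos : 0 < p ^ (c - j) := pow_pos hp.pos _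
    have hMj : ∀ i ∈ S, PtLead p n (M i) (p ^ (c - j)) 0 := fun i hi =>
      (hM i hi).lead (Nat.pow_lt_pow_right hp.one_lt (by omega))
    rw [← Finset.sum_subset (s₁ := S.filter fun i => j + 1 ≤ s i)]
    · refine Finset.sum_congr rfl fun i hi => ?_
      obtain ⟨hiS, hij⟩ := Finset.mem_filter.1 hi
      obtain ⟨h1, h2, h3⟩ := hs i hiS
      have h := (ptLead_dickson (p := p) (n := n) (i := n - s i + j) (by omega)
        (by omega)).pow_char_pow (μ i)
      rw [← pow_add, show n - (n - s i + j) - 1 + μ i = c - j by omega] at h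
      rw [steenrod_C_mul, (h.mul hpos (hMj i hiS)).steenrod_eq hpos, mul_zero, zero_add,
        mul_comm (M i), add_assoc]
    · intro i hi
      rw [Finset.mem_filter] at hi ⊢
      exact ⟨hi.1, by omega⟩
    · intro i hi hi'
      obtain ⟨hiS, hij⟩ := Finset.mem_filter.1 hi
      obtain ⟨h1, h2, h3⟩ := hs i hiS
      have hsij : s i = j := by
        have : ¬ j + 1 ≤ s i := fun h => hi' (Finset.mem_filter.2 ⟨hiS, h⟩)
        omega
      have h := ((ptLead_dickson_top (p := p) (n := n) (by omega)).pow_char_pow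
        (μ i)).stable
      rw [← pow_add] at h
      have h' := h.lead (l' := p ^ (c - j)) (Nat.pow_lt_pow_right hp.one_lt (by omega))
      rw [steenrod_C_mul, show n - s i + j = n by omega,
        (h'.mul hpos (hMj i hiS)).steenrod_eq hpos]
      simp

/-- The first operation `P^{p^c}` on a Dickson monomial, `c` being the least level. -/
theorem exists_steenrod_dickson_monomial {K m : ℕ → ℕ} {c : ℕ}
    (hm : ∀ i, 1 ≤ i → i ≤ n → K i ≠ 0 → p ^ m i ∣ K i ∧ ¬ p ^ (m i + 1) ∣ K i)
    (hc : ∀ i, 1 ≤ i → i ≤ n → K i ≠ 0 → c ≤ (if i = n then n else n - i) - 1 + m i) :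
    ∃ β : ℕ → ZMod p, (∀ i, β i ≠ 0) ∧
      steenrod p n (p ^ c) (∏ i ∈ Finset.Icc 1 n, dickson p n i ^ K i) =
        ∑ i ∈ (Finset.Icc 1 n).filter fun i =>
            K i ≠ 0 ∧ (if i = n then n else n - i) - 1 + m i = c,
          C (β i) * (dickson p n (n - (if i = n then n else n - i) + 1) ^ p ^ m i *
            ∏ l ∈ Finset.Icc 1 n,
              dickson p n l ^ (if l = i ∧ i ≠ n then K l - p ^ m l else K l)) := by
  have hp : p.Prime := Fact.out
  have key : ∀ i, ∃ β : ZMod p, β ≠ 0 ∧ (1 ≤ i → i ≤ n → K i ≠ 0 →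
      PtLead p n (dickson p n i ^ K i) (p ^ ((if i = n then n else n - i) - 1 + m i))
        (C β * (dickson p n (n - (if i = n then n else n - i) + 1) ^ p ^ m i *
          dickson p n i ^ (if i = n then K i else K i - p ^ m i)))) := by
    intro i
    by_cases h : 1 ≤ i ∧ i ≤ n ∧ K i ≠ 0
    · obtain ⟨h1, h2, h3⟩ := h
      obtain ⟨β, hβ, hL⟩ := ptLead_dickson_pow (p := p) h1 h2 (hm i h1 h2 h3).1
        (hm i h1 h2 h3).2
      exact ⟨β, hβ, fun _ _ _ => hL⟩
    · exact ⟨1, one_ne_zero, fun h1 h2 h3 => (h ⟨h1, h2, h3⟩).elim⟩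
  choose β hβ hL using key
  refine ⟨β, hβ, ?_⟩
  have hpos : 0 < p ^ c := pow_pos hp.pos c
  have hlead : ∀ i ∈ Finset.Icc 1 n, PtLead p n (dickson p n i ^ K i) (p ^ c)
      (if K i ≠ 0 ∧ (if i = n then n else n - i) - 1 + m i = c then
        C (β i) * (dickson p n (n - (if i = n then n else n - i) + 1) ^ p ^ m i *
          dickson p n i ^ (if i = n then K i else K i - p ^ m i)) else 0) := by
    intro i hi
    obtain ⟨h1, h2⟩ := Finset.mem_Icc.1 hi
    by_cases h3 : K i = 0
    · simpa [h3] using (PtStable.one_left (p := p) (n := n) (p ^ c + 1)).lead (Nat.lt_succ_self _)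
    · by_cases h4 : (if i = n then n else n - i) - 1 + m i = c
      · rw [if_pos ⟨h3, h4⟩]
        have h := hL i h1 h2 h3
        rwa [h4] at h
      · rw [if_neg fun h => h4 h.2]
        exact (hL i h1 h2 h3).stable.lead
          (Nat.pow_lt_pow_right hp.one_lt (lt_of_le_of_ne (hc i h1 h2 h3) (Ne.symm h4)))
  rw [(PtLead.prod hpos hlead).steenrod_eq hpos, Finset.sum_filter]
  refine Finset.sum_congr rfl fun i hi => ?_
  by_cases h : K i ≠ 0 ∧ (if i = n then n else n - i) - 1 + m i = c
  · rw [if_pos h, if_pos h, ← Finset.mul_prod_erase _ _ hi, mul_assoc, mul_assoc]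
    congr 3
    · by_cases hin : i = n <;> simp [hin]
    · refine Finset.prod_congr rfl fun l hl => ?_
      rw [if_neg fun h => Finset.ne_of_mem_erase hl h.1]
  · rw [if_neg h, if_neg h, zero_mul]

end Steenrod

/-- Theorem (Steenrod–Milnor step): for a monomial `d^K = ∏ d_{n,i}^{k(i)}`, `K ≠ 0`, with
`p^{m(i)}` the largest power of `p` dividing `k(i)` (for `k(i) ≠ 0`),
`c(i) = m(i) + n - i - 1` for `i < n`, `c(n) = m(n) + n - 1`,
`min(J) = min{c(i) : k(i) ≠ 0}` and `i_(J)` the associated maximum, there is a unit `u` with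
`P(min(J), i_(J))(d^K) = u·d_{n,n}^{p^{m(n)}}·d^K` if `i_(J) = n`, and
`P(min(J), i_(J))(d^K) = u·d_{n,n}^{p^{m(n-i_(J))}}·(d^K / d_{n,n-i_(J)}^{p^{m(n-i_(J))}})`
if `i_(J) < n`. -/
theorem Pcj_minJ_monomial (p n : ℕ) [Fact p.Prime] (K : ℕ → ℕ)
    (hK : ∃ i, 1 ≤ i ∧ i ≤ n ∧ K i ≠ 0)
    (m : ℕ → ℕ)
    (hm : ∀ i, 1 ≤ i → i ≤ n → K i ≠ 0 → p ^ m i ∣ K i ∧ ¬ p ^ (m i + 1) ∣ K i)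
    (cfun : ℕ → ℕ)
    (hc : ∀ i, 1 ≤ i → i ≤ n →
      (i < n → cfun i + i + 1 = m i + n) ∧ (i = n → cfun i + 1 = m i + n))
    (minJ : ℕ)
    (hminmem : minJ ∈ ((Finset.Icc 1 n).filter fun i => K i ≠ 0).image cfun)
    (hminle : ∀ x ∈ ((Finset.Icc 1 n).filter fun i => K i ≠ 0).image cfun, minJ ≤ x)
    (iJ : ℕ)
    (hiJmem : iJ ∈ ((Finset.Icc 1 n).filter fun i => K i ≠ 0 ∧ cfun i = minJ).image
      fun i => if i = n then n else n - i)
    (hiJmax : ∀ x ∈ ((Finset.Icc 1 n).filter fun i => K i ≠ 0 ∧ cfun i = minJ).image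
      fun i => if i = n then n else n - i, x ≤ iJ) :
    ∃ u : (ZMod p)ˣ,
      (iJ = n →
        Pcj p n minJ iJ (∏ i ∈ Finset.Icc 1 n, dickson p n i ^ K i) =
          (u : ZMod p) •
            (dickson p n n ^ p ^ m n * ∏ i ∈ Finset.Icc 1 n, dickson p n i ^ K i)) ∧
      (iJ < n →
        Pcj p n minJ iJ (∏ i ∈ Finset.Icc 1 n, dickson p n i ^ K i) =
          (u : ZMod p) •
            (dickson p n n ^ p ^ m (n - iJ) *
              ∏ i ∈ Finset.Icc 1 n,
                dickson p n i ^ (if i = n - iJ then K i - p ^ m i else K i))) := by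
  have hp : p.Prime := Fact.out
  set s : ℕ → ℕ := fun i => if i = n then n else n - i with hs
  have hsb : ∀ i, 1 ≤ i → i ≤ n → 1 ≤ s i ∧ s i ≤ n ∧ cfun i + 1 = m i + s i := by
    intro i h1 h2
    obtain ⟨ha, hb⟩ := hc i h1 h2
    simp only [hs]
    split_ifs with h
    · have := hb h
      omega
    · have := ha (by omega)
      omega
  have hle : ∀ i, 1 ≤ i → i ≤ n → K i ≠ 0 → minJ ≤ cfun i := fun i h1 h2 h3 =>
    hminle _ (Finset.mem_image_of_mem _ (Finset.mem_filter.2 ⟨Finset.mem_Icc.2 ⟨h1, h2⟩, h3⟩))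
  obtain ⟨i₀, hi₀, rfl⟩ := Finset.mem_image.1 hiJmem
  change ∀ x ∈ Finset.image s _, x ≤ s i₀ at hiJmax
  change ∃ u : (ZMod p)ˣ, (s i₀ = n → _) ∧ (s i₀ < n → _)
  obtain ⟨hi₀m, hKi₀, hci₀⟩ := Finset.mem_filter.1 hi₀
  obtain ⟨h1, h2⟩ := Finset.mem_Icc.1 hi₀m
  obtain ⟨hs1, hs2, hs3⟩ := hsb i₀ h1 h2
  obtain ⟨β, hβ, hst⟩ := exists_steenrod_dickson_monomial (p := p) (n := n) (c := minJ) hm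
    fun i h1 h2 h3 => by
      have := hle i h1 h2 h3
      have h4 := hsb i h1 h2
      change minJ ≤ s i - 1 + m i
      omega
  have hP := Pcj_eq_sum_of_steenrod_eq (s := s) (μ := m) ?_ ?_ hst (j := s i₀) hs1 (by omega)
  · have hsum : (((Finset.Icc 1 n).filter fun i =>
        K i ≠ 0 ∧ (if i = n then n else n - i) - 1 + m i = minJ).filter fun i => s i₀ ≤ s i) =
        {i₀} := by
      ext i
      simp only [Finset.mem_filter, Finset.mem_Icc, Finset.mem_singleton]
      constructor
      · rintro ⟨⟨⟨h3, h4⟩, h5, h6⟩, h7⟩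
        change s i - 1 + m i = minJ at h6
        obtain ⟨h8, h9, h10⟩ := hsb i h3 h4
        have h11 := hiJmax (s i) (Finset.mem_image_of_mem _ (Finset.mem_filter.2
          ⟨Finset.mem_Icc.2 ⟨h3, h4⟩, h5, by omega⟩))
        have h12 : s i = s i₀ := le_antisymm h11 h7
        simp only [hs] at h12
        split_ifs at h12 <;> omega
      · rintro rfl
        refine ⟨⟨⟨h1, h2⟩, hKi₀, ?_⟩, le_rfl⟩
        change s i - 1 + m i = minJ
        omega
    rw [hsum, Finset.sum_singleton, Nat.sub_add_cancel hs2, ← smul_eq_C_mul] at hP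
    refine ⟨Units.mk0 (β i₀) (hβ i₀), fun hsn => ?_, fun hsn => ?_⟩
    · have hin : i₀ = n := by
        simp only [hs] at hsn
        split_ifs at hsn <;> omega
      rw [hP, Units.val_mk0]
      simp [hin]
    · have hin : i₀ ≠ n := by
        intro h
        simp [hs, h] at hsn
      have hsub : n - s i₀ = i₀ := by
        simp only [hs, if_neg hin]
        omega
      rw [hP, Units.val_mk0, hsub]
      simp [hin]
  · intro i hi
    obtain ⟨hi1, hi2, hi3⟩ := Finset.mem_filter.1 hi
    change s i - 1 + m i = minJ at hi3
    obtain ⟨h3, h4⟩ := Finset.mem_Icc.1 hi1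
    have := hsb i h3 h4
    omega
  · intro i _
    refine PtStable.prod fun l hl => ?_
    obtain ⟨h3, h4⟩ := Finset.mem_Icc.1 hl
    by_cases hKl : K l = 0
    · simpa [hKl] using PtStable.one_left _
    have hd := (hm l h3 h4 hKl).1
    refine (ptStable_dickson_pow (μ := m l) h3 h4 ?_).mono
      (Nat.pow_le_pow_right hp.pos ?_)
    · split_ifs
      · exact Nat.dvd_sub hd dvd_rfl
      · exact hd
    · have h5 := hle l h3 h4 hKl
      have h6 := hsb l h3 h4
      change minJ ≤ s l - 1 + m l
      omega
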